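/- arXiv:2204.03878 — 2 statements merged into one kernel-verified Lean document; each statement's English description precedes it below -/
import Mathlib

section
/- Let τ : [0,1] → [0,+∞] be a continuous strictly decreasing bijection with τ(1) = 0 and τ(0) = +∞, ζ(u) = τ(1−u), and let ω = (ω₁,…,ωₙ) be a weight vector. The operator PFIWG_{T,ω} is monotone with respect to ⊆ and ≼_W: if αⱼ and βⱼ (j = 1,…,n) are PFNs with μ_{αⱼ} ≤ μ_{βⱼ}, η_{αⱼ} ≤ η_{βⱼ}, and ν_{αⱼ} ≥ ν_{βⱼ} for every j, then PFIWG_{T,ω}(α₁,…,αₙ) ≼_W PFIWG_{T,ω}(β₁,…,βₙ). -/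
open scoped ENNReal

/-- A picture fuzzy number (PFN): a triple of reals in `[0,1]` whose sum is at most `1`. -/
structure PFN where
  mu : ℝ
  eta : ℝ
  nu : ℝ
  mu_nonneg : 0 ≤ mu
  mu_le_one : mu ≤ 1
  eta_nonneg : 0 ≤ eta
  eta_le_one : eta ≤ 1
  nu_nonneg : 0 ≤ nu
  nu_le_one : nu ≤ 1
  sum_le_one : mu + eta + nu ≤ 1

/-- The underlying triple of a PFN. -/
def PFN.toProd (a : PFN) : ℝ × ℝ × ℝ := (a.mu, a.eta, a.nu)

/-- A triple of reals satisfies the PFN conditions: all three components lie in `[0,1]`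
and their sum is at most `1`. -/
def isPFN (t : ℝ × ℝ × ℝ) : Prop :=
  0 ≤ t.1 ∧ t.1 ≤ 1 ∧ 0 ≤ t.2.1 ∧ t.2.1 ≤ 1 ∧ 0 ≤ t.2.2 ∧ t.2.2 ≤ 1 ∧
    t.1 + t.2.1 + t.2.2 ≤ 1

/-- Score function on triples. -/
def scoreP (a : ℝ × ℝ × ℝ) : ℝ := a.1 - a.2.2

/-- First accuracy function on triples. -/
def H1P (a : ℝ × ℝ × ℝ) : ℝ := a.1 + a.2.2

/-- Second accuracy function on triples. -/
def H2P (a : ℝ × ℝ × ℝ) : ℝ := a.1 + a.2.1 + a.2.2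

/-- The order `≼_W` on triples. -/
def leWP (a b : ℝ × ℝ × ℝ) : Prop :=
  scoreP a < scoreP b ∨
    (scoreP a = scoreP b ∧ H1P a < H1P b) ∨
    (scoreP a = scoreP b ∧ H1P a = H1P b ∧ H2P a ≤ H2P b)

/-- An additive generator of a strict t-norm: a continuous, strictly decreasing bijection
`τ : [0,1] → [0,+∞]` with `τ(1) = 0` and `τ(0) = +∞`, together with its inverse. -/
structure Gen where
  tau : ℝ → ℝ≥0∞
  tauInv : ℝ≥0∞ → ℝ
  continuousOn : ContinuousOn tau (Set.Icc 0 1)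
  strictAntiOn : StrictAntiOn tau (Set.Icc 0 1)
  tauInv_mem : ∀ y, tauInv y ∈ Set.Icc (0:ℝ) 1
  leftInv : ∀ x ∈ Set.Icc (0:ℝ) 1, tauInv (tau x) = x
  rightInv : ∀ y, tau (tauInv y) = y
  tau_one : tau 1 = 0
  tau_zero : tau 0 = ⊤

/-- `ζ(u) = τ(1-u)`. -/
noncomputable def Gen.zeta (g : Gen) (u : ℝ) : ℝ≥0∞ := g.tau (1 - u)

/-- `ζ⁻¹(y) = 1 - τ⁻¹(y)`. -/
noncomputable def Gen.zetaInv (g : Gen) (y : ℝ≥0∞) : ℝ := 1 - g.tauInv y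

/-- A weight vector: all entries in `(0,1]` summing to `1`. -/
def IsWeight {n : ℕ} (ω : Fin n → ℝ) : Prop :=
  (∀ j, 0 < ω j ∧ ω j ≤ 1) ∧ ∑ j, ω j = 1

/-- The picture fuzzy interactional weighted geometric operator `PFIWG_{T,ω}` (closed form). -/
noncomputable def PFIWG (g : Gen) {n : ℕ} (ω : Fin n → ℝ) (a : Fin n → ℝ × ℝ × ℝ) :
    ℝ × ℝ × ℝ :=
  (g.tauInv (∑ j, ENNReal.ofReal (ω j) * g.tau (a j).1),
   g.tauInv (∑ j, ENNReal.ofReal (ω j) * g.tau ((a j).2.1 + (a j).1)) -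
     g.tauInv (∑ j, ENNReal.ofReal (ω j) * g.tau (a j).1),
   g.zetaInv (∑ j, ENNReal.ofReal (ω j) * g.zeta (a j).2.2))

theorem Gen.tauInv_antitone (g : Gen) : Antitone g.tauInv := fun y z h => by
  rwa [← g.strictAntiOn.le_iff_ge (g.tauInv_mem y) (g.tauInv_mem z), g.rightInv, g.rightInv]

/-- Weighted means generated by `τ` are monotone in their arguments. -/
theorem Gen.tauInv_sum_mono (g : Gen) {n : ℕ} (ω : Fin n → ℝ) {x y : Fin n → ℝ}
    (hx : ∀ j, 0 ≤ x j) (hxy : ∀ j, x j ≤ y j) (hy : ∀ j, y j ≤ 1) :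
    g.tauInv (∑ j, ENNReal.ofReal (ω j) * g.tau (x j)) ≤
      g.tauInv (∑ j, ENNReal.ofReal (ω j) * g.tau (y j)) :=
  g.tauInv_antitone <| Finset.sum_le_sum fun j _ => mul_le_mul_right
    (g.strictAntiOn.antitoneOn ⟨hx j, (hxy j).trans (hy j)⟩ ⟨(hx j).trans (hxy j), hy j⟩ (hxy j)) _

/-- Increasing the first component and the sum of the first two, and decreasing the third,
increases a triple for `≼_W`. -/
theorem leWP_of_le {a b : ℝ × ℝ × ℝ} (hmu : a.1 ≤ b.1) (hsum : a.1 + a.2.1 ≤ b.1 + b.2.1)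
    (hnu : b.2.2 ≤ a.2.2) : leWP a b := by
  unfold leWP scoreP H1P H2P
  rcases hmu.lt_or_eq with h | h
  · left; linarith
  rcases hnu.lt_or_eq with h' | h'
  · left; linarith
  · right; right
    exact ⟨by linarith, by linarith, by linarith⟩

/-- Monotonicity of `PFIWG_{T,ω}`: if `αⱼ ⊆ βⱼ` componentwise for every `j`, then
`PFIWG_{T,ω}(α₁,…,αₙ) ≼_W PFIWG_{T,ω}(β₁,…,βₙ)`. -/
theorem PFIWG_monotone (g : Gen) (n : ℕ) (ω : Fin n → ℝ) (hω : IsWeight ω)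
    (α β : Fin n → PFN)
    (hmu : ∀ j, (α j).mu ≤ (β j).mu)
    (heta : ∀ j, (α j).eta ≤ (β j).eta)
    (hnu : ∀ j, (β j).nu ≤ (α j).nu) :
    leWP (PFIWG g ω (fun j => (α j).toProd)) (PFIWG g ω (fun j => (β j).toProd)) := by
  apply leWP_of_le
  · exact g.tauInv_sum_mono ω (fun j => (α j).mu_nonneg) hmu (fun j => (β j).mu_le_one)
  · have h := g.tauInv_sum_mono ω (x := fun j => (α j).eta + (α j).mu)
      (y := fun j => (β j).eta + (β j).mu)
      (fun j => add_nonneg (α j).eta_nonneg (α j).mu_nonneg)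
      (fun j => add_le_add (heta j) (hmu j))
      (fun j => by linarith [(β j).sum_le_one, (β j).nu_nonneg])
    simpa [PFIWG, PFN.toProd] using h
  · exact sub_le_sub_left (g.tauInv_sum_mono ω (fun j => sub_nonneg.2 (α j).nu_le_one)
      (fun j => sub_le_sub_left (hnu j) 1) (fun j => sub_le_self 1 (β j).nu_nonneg)) 1
end

section
/- Let τ : [0,1] → [0,+∞] be a continuous strictly decreasing bijection with τ(1) = 0 and τ(0) = +∞, ζ(u) = τ(1−u), and let ω = (ω₁,…,ωₙ) be a weight vector. For any PFNs αⱼ = ⟨μⱼ,ηⱼ,νⱼ⟩ (j = 1,…,n, n ≥ 1), the operator PFIWG_{T,ω} is bounded: ⟨min_j μⱼ, min_j ηⱼ, max_j νⱼ⟩ ≼_W PFIWG_{T,ω}(α₁,…,αₙ) ≼_W ⟨max_j μⱼ, 1 − (max_j μⱼ + min_j νⱼ), min_j νⱼ⟩, where both bounding triples are themselves PFNs. -/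
open scoped ENNReal

/-- The weighted quasi-arithmetic mean generated by `τ`. -/
noncomputable def Gen.mean (g : Gen) {n : ℕ} (ω x : Fin n → ℝ) : ℝ :=
  g.tauInv (∑ j, ENNReal.ofReal (ω j) * g.tau (x j))

theorem Gen.mean_mono (g : Gen) {n : ℕ} (ω : Fin n → ℝ) {x y : Fin n → ℝ}
    (hx : ∀ j, 0 ≤ x j) (hxy : ∀ j, x j ≤ y j) (hy : ∀ j, y j ≤ 1) :
    g.mean ω x ≤ g.mean ω y := by
  refine g.tauInv_antitone (Finset.sum_le_sum fun j _ => mul_le_mul_right ?_ _)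
  exact g.strictAntiOn.antitoneOn ⟨hx j, (hxy j).trans (hy j)⟩
    ⟨(hx j).trans (hxy j), hy j⟩ (hxy j)

theorem Gen.mean_const (g : Gen) {n : ℕ} {ω : Fin n → ℝ} (hω : IsWeight ω) {c : ℝ}
    (hc : c ∈ Set.Icc (0 : ℝ) 1) : g.mean ω (fun _ => c) = c := by
  rw [Gen.mean, ← Finset.sum_mul, ← ENNReal.ofReal_sum_of_nonneg fun j _ => (hω.1 j).1.le,
    hω.2, ENNReal.ofReal_one, one_mul, g.leftInv c hc]

theorem Gen.le_mean (g : Gen) {n : ℕ} {ω : Fin n → ℝ} (hω : IsWeight ω) {c : ℝ}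
    {x : Fin n → ℝ} (hc : 0 ≤ c) (hc' : c ≤ 1) (hcx : ∀ j, c ≤ x j) (hx : ∀ j, x j ≤ 1) :
    c ≤ g.mean ω x :=
  (g.mean_const hω ⟨hc, hc'⟩).symm.le.trans (g.mean_mono ω (fun _ => hc) hcx hx)

theorem Gen.mean_le (g : Gen) {n : ℕ} {ω : Fin n → ℝ} (hω : IsWeight ω) {c : ℝ}
    {x : Fin n → ℝ} (hc : 0 ≤ c) (hc' : c ≤ 1) (hx : ∀ j, 0 ≤ x j) (hxc : ∀ j, x j ≤ c) :
    g.mean ω x ≤ c :=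
  (g.mean_mono ω hx hxc fun _ => hc').trans (g.mean_const hω ⟨hc, hc'⟩).le

theorem PFIWG_toProd (g : Gen) {n : ℕ} (ω : Fin n → ℝ) (α : Fin n → PFN) :
    PFIWG g ω (fun j => (α j).toProd) =
      (g.mean ω (fun j => (α j).mu),
       g.mean ω (fun j => (α j).eta + (α j).mu) - g.mean ω (fun j => (α j).mu),
       1 - g.mean ω (fun j => 1 - (α j).nu)) :=
  rfl

/-- Comparison of triples whose memberships and non-memberships are ordered oppositely. -/
theorem leWP_of_mu_le_of_nu_le {a b : ℝ × ℝ × ℝ} (hmu : a.1 ≤ b.1) (hnu : b.2.2 ≤ a.2.2)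
    (heta : a.1 = b.1 → a.2.2 = b.2.2 → a.2.1 ≤ b.2.1) : leWP a b := by
  unfold leWP scoreP H1P H2P
  by_cases h : a.1 - a.2.2 < b.1 - b.2.2
  · exact Or.inl h
  · have h1 : a.1 = b.1 := by linarith
    have h2 : a.2.2 = b.2.2 := by linarith
    have := heta h1 h2
    exact Or.inr (Or.inr ⟨by linarith, by linarith, by linarith⟩)

/-- Boundedness of `PFIWG_{T,ω}`:
`⟨min μⱼ, min ηⱼ, max νⱼ⟩ ≼_W PFIWG_{T,ω}(α₁,…,αₙ)
  ≼_W ⟨max μⱼ, 1 − (max μⱼ + min νⱼ), min νⱼ⟩`,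
and both bounding triples are themselves PFNs. -/
theorem PFIWG_bounded (g : Gen) (n : ℕ) (ω : Fin (n + 1) → ℝ) (hω : IsWeight ω)
    (α : Fin (n + 1) → PFN) :
    isPFN (Finset.univ.inf' Finset.univ_nonempty (fun j => (α j).mu),
           Finset.univ.inf' Finset.univ_nonempty (fun j => (α j).eta),
           Finset.univ.sup' Finset.univ_nonempty (fun j => (α j).nu)) ∧
    isPFN (Finset.univ.sup' Finset.univ_nonempty (fun j => (α j).mu),
           1 - (Finset.univ.sup' Finset.univ_nonempty (fun j => (α j).mu) +
                Finset.univ.inf' Finset.univ_nonempty (fun j => (α j).nu)),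
           Finset.univ.inf' Finset.univ_nonempty (fun j => (α j).nu)) ∧
    leWP (Finset.univ.inf' Finset.univ_nonempty (fun j => (α j).mu),
          Finset.univ.inf' Finset.univ_nonempty (fun j => (α j).eta),
          Finset.univ.sup' Finset.univ_nonempty (fun j => (α j).nu))
      (PFIWG g ω (fun j => (α j).toProd)) ∧
    leWP (PFIWG g ω (fun j => (α j).toProd))
      (Finset.univ.sup' Finset.univ_nonempty (fun j => (α j).mu),
       1 - (Finset.univ.sup' Finset.univ_nonempty (fun j => (α j).mu) +
            Finset.univ.inf' Finset.univ_nonempty (fun j => (α j).nu)),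
       Finset.univ.inf' Finset.univ_nonempty (fun j => (α j).nu)) := by
  have minMu_le : ∀ j, Finset.univ.inf' Finset.univ_nonempty (fun j => (α j).mu) ≤ (α j).mu :=
    fun j => Finset.inf'_le _ (Finset.mem_univ j)
  have minEta_le : ∀ j,
      Finset.univ.inf' Finset.univ_nonempty (fun j => (α j).eta) ≤ (α j).eta :=
    fun j => Finset.inf'_le _ (Finset.mem_univ j)
  have minNu_le : ∀ j, Finset.univ.inf' Finset.univ_nonempty (fun j => (α j).nu) ≤ (α j).nu :=
    fun j => Finset.inf'_le _ (Finset.mem_univ j)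
  have le_maxMu : ∀ j, (α j).mu ≤ Finset.univ.sup' Finset.univ_nonempty (fun j => (α j).mu) :=
    fun j => Finset.le_sup' (fun j => (α j).mu) (Finset.mem_univ j)
  have le_maxNu : ∀ j, (α j).nu ≤ Finset.univ.sup' Finset.univ_nonempty (fun j => (α j).nu) :=
    fun j => Finset.le_sup' (fun j => (α j).nu) (Finset.mem_univ j)
  have minMu_nonneg : 0 ≤ Finset.univ.inf' Finset.univ_nonempty (fun j => (α j).mu) :=
    Finset.le_inf' _ _ fun j _ => (α j).mu_nonneg
  have minEta_nonneg : 0 ≤ Finset.univ.inf' Finset.univ_nonempty (fun j => (α j).eta) :=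
    Finset.le_inf' _ _ fun j _ => (α j).eta_nonneg
  have minNu_nonneg : 0 ≤ Finset.univ.inf' Finset.univ_nonempty (fun j => (α j).nu) :=
    Finset.le_inf' _ _ fun j _ => (α j).nu_nonneg
  obtain ⟨p, -, hp⟩ :=
    Finset.exists_mem_eq_sup' Finset.univ_nonempty (fun j => (α j).mu)
  obtain ⟨q, -, hq⟩ :=
    Finset.exists_mem_eq_sup' Finset.univ_nonempty (fun j => (α j).nu)
  generalize Finset.univ.inf' Finset.univ_nonempty (fun j => (α j).mu) = minMu at *
  generalize Finset.univ.inf' Finset.univ_nonempty (fun j => (α j).eta) = minEta at *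
  generalize Finset.univ.inf' Finset.univ_nonempty (fun j => (α j).nu) = minNu at *
  generalize Finset.univ.sup' Finset.univ_nonempty (fun j => (α j).mu) = maxMu at *
  generalize Finset.univ.sup' Finset.univ_nonempty (fun j => (α j).nu) = maxNu at *
  have mu_nonneg := fun j => (α j).mu_nonneg
  have eta_nonneg := fun j => (α j).eta_nonneg
  have nu_nonneg := fun j => (α j).nu_nonneg
  have sum_le := fun j => (α j).sum_le_one
  have hmaxMu : 0 ≤ maxMu ∧ maxMu + minNu ≤ 1 := by
    constructor <;> linarith [mu_nonneg p, eta_nonneg p, minNu_le p, sum_le p]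
  have hmaxNu : 0 ≤ maxNu ∧ minMu + minEta + maxNu ≤ 1 := by
    constructor <;> linarith [nu_nonneg q, minMu_le q, minEta_le q, sum_le q]
  obtain ⟨maxMu_nonneg, maxMu_add_le⟩ := hmaxMu
  obtain ⟨maxNu_nonneg, minMu_add_le⟩ := hmaxNu
  rw [PFIWG_toProd]
  refine ⟨?_, ?_, leWP_of_mu_le_of_nu_le ?_ ?_ ?_, leWP_of_mu_le_of_nu_le ?_ ?_ ?_⟩
  · refine ⟨?_, ?_, ?_, ?_, ?_, ?_, ?_⟩ <;> dsimp only <;> linarith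
  · refine ⟨?_, ?_, ?_, ?_, ?_, ?_, ?_⟩ <;> dsimp only <;> linarith
  · exact g.le_mean hω minMu_nonneg (by linarith) minMu_le fun j => (α j).mu_le_one
  · have := g.le_mean hω (c := 1 - maxNu) (x := fun j => 1 - (α j).nu) (by linarith)
      (by linarith) (fun j => by linarith [le_maxNu j]) (fun j => by linarith [nu_nonneg j])
    dsimp only
    linarith
  · intro hmu _
    have := g.le_mean hω (c := minEta + minMu) (x := fun j => (α j).eta + (α j).mu)
      (by linarith) (by linarith) (fun j => by linarith [minEta_le j, minMu_le j])
      (fun j => by linarith [nu_nonneg j, sum_le j])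
    dsimp only at hmu ⊢
    linarith
  · exact g.mean_le hω maxMu_nonneg (by linarith) mu_nonneg le_maxMu
  · have := g.mean_le hω (c := 1 - minNu) (x := fun j => 1 - (α j).nu) (by linarith)
      (by linarith) (fun j => by linarith [mu_nonneg j, eta_nonneg j, sum_le j])
      (fun j => by linarith [minNu_le j])
    dsimp only
    linarith
  · intro hmu hnu
    have := g.mean_mono ω (x := fun j => (α j).eta + (α j).mu) (y := fun j => 1 - (α j).nu)
      (fun j => by linarith [eta_nonneg j, mu_nonneg j]) (fun j => by linarith [sum_le j])
      (fun j => by linarith [nu_nonneg j])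
    dsimp only at hmu hnu ⊢
    linarith
end
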